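/- Let U = {(x, y) ∈ ℝ² : xy ≥ 1 and x > 0}. If a polynomial h ∈ ℝ[x, y] satisfies h(x, y) ≥ 0 for all (x, y) ∈ U and h(x, y) ≤ 0 for all (x, y) ∈ ℝ² ∖ U, then h = 0. In particular, the separating ideal ⟨U, ℝ² ∖ U⟩ is the zero ideal. -/

import Mathlib

open MvPolynomial

/-- The region `U = {(x, y) ∈ ℝ² : xy ≥ 1, x > 0}`, with points of `ℝ²`
represented as functions `Fin 2 → ℝ`. -/
def hyperbolaRegion : Set (Fin 2 → ℝ) :=
  {v | 1 ≤ v 0 * v 1 ∧ 0 < v 0}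

/-- The separating ideal `⟨U, V⟩` of two subsets of `ℝ²`: the ideal generated by
all polynomials that are nonnegative on `U` and nonpositive on `V`. -/
noncomputable def sepIdeal (U V : Set (Fin 2 → ℝ)) :
    Ideal (MvPolynomial (Fin 2) ℝ) :=
  Ideal.span {h | (∀ x ∈ U, 0 ≤ eval x h) ∧ ∀ x ∈ V, eval x h ≤ 0}

/-- A polynomial that is nonnegative near `+∞` has nonnegative leading coefficient. -/
theorem lc_nonneg_aux (p : Polynomial ℝ) (M : ℝ) (hp : ∀ x, M < x → 0 ≤ p.eval x) :
    0 ≤ p.leadingCoeff := by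
  by_contra hlt
  push Not at hlt
  by_cases hd : 0 < p.degree
  · have ht := p.tendsto_atBot_of_leadingCoeff_nonpos hd hlt.le
    obtain ⟨x, hx1, hx2⟩ := ((ht.eventually (Filter.eventually_lt_atBot 0)).and
      (Filter.eventually_gt_atTop M)).exists
    exact absurd (hp x hx2) (not_le.mpr hx1)
  · have hc := Polynomial.eq_C_of_degree_le_zero (not_lt.mp hd)
    have h1 := hp (M + 1) (by linarith)
    rw [hc] at h1 hlt
    simp at h1 hlt
    linarith

theorem lc_nonpos_aux (p : Polynomial ℝ) (M : ℝ) (hp : ∀ x, M < x → p.eval x ≤ 0) :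
    p.leadingCoeff ≤ 0 := by
  have := lc_nonneg_aux (-p) M (fun x hx => by simpa using hp x hx)
  simpa using this

theorem lc_neg_aux (p : Polynomial ℝ) (M : ℝ) (hp : ∀ x, x < M → p.eval x ≤ 0) :
    p.leadingCoeff * (-1) ^ p.natDegree ≤ 0 := by
  have := lc_nonpos_aux (p.comp (-Polynomial.X)) (-M)
    (fun x hx => by simpa using hp (-x) (by linarith))
  rw [Polynomial.leadingCoeff_comp (by simp)] at this
  simpa using this

theorem exists_eval_ne_aux (a : MvPolynomial (Fin 1) ℝ) (ha : a ≠ 0) (S : Set ℝ)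
    (hS : S.Infinite) : ∃ s : Fin 1 → ℝ, s 0 ∈ S ∧ eval s a ≠ 0 := by
  by_contra hcon
  push Not at hcon
  apply ha
  apply MvPolynomial.funext_set (fun _ => S) (fun _ => hS)
  intro x hx
  rw [hcon x (hx 0 (Set.mem_univ _)), map_zero]

theorem main_aux (h : MvPolynomial (Fin 2) ℝ)
    (h₁ : ∀ v ∈ hyperbolaRegion, 0 ≤ eval v h)
    (h₂ : ∀ v ∈ hyperbolaRegionᶜ, eval v h ≤ 0) : h = 0 := by
  by_contra hne
  have hP : finSuccEquiv ℝ 1 h ≠ 0 := by simpa using hne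
  have ha : (finSuccEquiv ℝ 1 h).leadingCoeff ≠ 0 := by simpa using hP
  obtain ⟨s, hs, hsa⟩ := exists_eval_ne_aux _ ha (Set.Ioi 0) (Set.Ioi_infinite 0)
  obtain ⟨t, ht, hta⟩ := exists_eval_ne_aux _ ha (Set.Iio 0) (Set.Iio_infinite 0)
  have hs' : 0 < s 0 := hs
  have ht' : t 0 < 0 := ht
  have e : ∀ (x : ℝ) (r : Fin 1 → ℝ), Polynomial.eval x
      (Polynomial.map (eval r) (finSuccEquiv ℝ 1 h)) = eval (Fin.cons x r : Fin 2 → ℝ) h :=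
    fun x r => (eval_eq_eval_mv_eval' r x h).symm
  have c0 : ∀ (x : ℝ) (r : Fin 1 → ℝ), (Fin.cons x r : Fin 2 → ℝ) ∈ hyperbolaRegion ↔
      1 ≤ x * r 0 ∧ 0 < x := fun x r => Iff.rfl
  have ls := Polynomial.leadingCoeff_map_of_leadingCoeff_ne_zero (eval s) hsa
  have lt := Polynomial.leadingCoeff_map_of_leadingCoeff_ne_zero (eval t) hta
  have ds := Polynomial.natDegree_map_of_leadingCoeff_ne_zero (eval s) hsa
  have dt := Polynomial.natDegree_map_of_leadingCoeff_ne_zero (eval t) hta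
  have A := lc_nonneg_aux (Polynomial.map (eval s) (finSuccEquiv ℝ 1 h)) (1 / s 0) (by
    intro x hx
    rw [e]
    refine h₁ _ ((c0 _ _).2 ⟨?_, lt_trans (by positivity) hx⟩)
    rw [div_lt_iff₀ hs'] at hx
    exact hx.le)
  have B := lc_neg_aux (Polynomial.map (eval s) (finSuccEquiv ℝ 1 h)) 0 (by
    intro x hx
    rw [e]
    refine h₂ _ (fun hm => ?_)
    have := ((c0 _ _).1 hm).2
    linarith)
  have hT : ∀ x, Polynomial.eval x (Polynomial.map (eval t) (finSuccEquiv ℝ 1 h)) ≤ 0 := by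
    intro x
    rw [e]
    refine h₂ _ (fun hm => ?_)
    have := (c0 _ _).1 hm
    nlinarith [this.1, this.2]
  have C' := lc_nonpos_aux _ 0 (fun x _ => hT x)
  have D := lc_neg_aux _ 0 (fun x _ => hT x)
  rw [ds] at B
  rw [dt] at D
  rw [ls] at A B
  rw [lt] at C' D
  rcases Nat.even_or_odd (finSuccEquiv ℝ 1 h).natDegree with hn | hn
  · rw [hn.neg_one_pow, mul_one] at B
    exact hsa (le_antisymm B A)
  · rw [hn.neg_one_pow] at D
    exact hta (le_antisymm C' (by linarith))

/-- Any polynomial nonnegative on `U = {(x,y) : xy ≥ 1, x > 0}` and nonpositive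
on its complement is zero; in particular `⟨U, ℝ² ∖ U⟩` is the zero ideal. -/
theorem sepIdeal_hyperbolaRegion_eq_bot
    (h : MvPolynomial (Fin 2) ℝ)
    (h₁ : ∀ v ∈ hyperbolaRegion, 0 ≤ eval v h)
    (h₂ : ∀ v ∈ hyperbolaRegionᶜ, eval v h ≤ 0) :
    h = 0 ∧ sepIdeal hyperbolaRegion hyperbolaRegionᶜ = ⊥ := by
  refine ⟨main_aux h h₁ h₂, ?_⟩
  unfold sepIdeal
  rw [Ideal.span_eq_bot]
  exact fun g hg => main_aux g hg.1 hg.2
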